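/- arXiv:math/0603058 — 5 statements merged into one kernel-verified Lean document; each statement's English description precedes it below -/
import Mathlib

section
/- The seven least significant bits of the SHR3 output x + T(x) are exactly uniformly distributed: for every 32-bit word r with r < 128, the number of 32-bit words x such that (x + T(x)) &&& 127 = r is exactly 2^25. -/
instance : Fintype (BitVec 32) :=
  Fintype.ofEquiv (Fin (2 ^ 32)) ⟨BitVec.ofFin, BitVec.toFin, fun _ => rfl, fun _ => rfl⟩

/-- The SHR xorshift transformation of Marsaglia–Tsang's SHR3 generator. -/
def T (x : BitVec 32) : BitVec 32 :=
  let y₁ := x ^^^ (x <<< 13)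
  let y₂ := y₁ ^^^ (y₁ >>> 17)
  y₂ ^^^ (y₂ <<< 5)

theorem getLsbD_T (x : BitVec 32) {i : ℕ} (hi : i < 7) :
    (T x).getLsbD i =
      ((x.getLsbD i ^^ (x.getLsbD (i + 17) ^^ x.getLsbD (i + 4))) ^^
        (decide (5 ≤ i) &&
          (x.getLsbD (i - 5) ^^ (x.getLsbD (i + 12) ^^ x.getLsbD (i - 1))))) := by
  interval_cases i <;> simp [T]

/-- The seven low bits of `T x`, together with the bits of `x` outside positions 17 to 23,
determine `x`. -/
theorem eq_of_T_low_bits_eq {x y : BitVec 32}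
    (hxy : ∀ i, i < 17 ∨ 24 ≤ i → x.getLsbD i = y.getLsbD i)
    (hT : ∀ i < 7, (T x).getLsbD i = (T y).getLsbD i) : x = y := by
  have low (i : ℕ) (hi : i < 5) : x.getLsbD (i + 17) = y.getLsbD (i + 17) := by
    have h := hT i (by lia)
    rw [getLsbD_T x (by lia), getLsbD_T y (by lia), hxy i (by lia), hxy (i + 4) (by lia)] at h
    simpa [show ¬ 5 ≤ i by lia] using h
  have high (i : ℕ) (hi : 5 ≤ i) (hi' : i < 7) : x.getLsbD (i + 17) = y.getLsbD (i + 17) := by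
    have h := hT i hi'
    rw [getLsbD_T x hi', getLsbD_T y hi', hxy i (by lia), hxy (i + 4) (by lia),
      hxy (i - 5) (by lia), hxy (i - 1) (by lia)] at h
    have h12 : x.getLsbD (i + 12) = y.getLsbD (i + 12) := by
      simpa [show i - 5 + 17 = i + 12 by lia] using low (i - 5) (by lia)
    simpa [h12] using h
  refine BitVec.eq_of_getLsbD_eq fun i _ => ?_
  by_cases h : i < 17 ∨ 24 ≤ i
  · exact hxy i h
  · obtain ⟨j, rfl⟩ : ∃ j, i = j + 17 := ⟨i - 17, by lia⟩
    by_cases hj : j < 5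
    · exact low j hj
    · exact high j (by lia) (by lia)

/-- The bits of `x` at positions 24 to 31 and 0 to 16, and the seven low bits of the output
`x + T x`. -/
def splitOutput (x : BitVec 32) : (Fin (2 ^ 8) × Fin (2 ^ 17)) × Fin (2 ^ 7) :=
  (((x.extractLsb' 24 8).toFin, (x.setWidth 17).toFin), ((x + T x).setWidth 7).toFin)

theorem splitOutput_injective : Function.Injective splitOutput := by
  intro x y h
  simp only [splitOutput, Prod.mk.injEq, BitVec.toFin_inj] at h
  obtain ⟨⟨hhigh, hlow⟩, hout⟩ := h
  have hxy (i : ℕ) (hi : i < 17 ∨ 24 ≤ i) : x.getLsbD i = y.getLsbD i := by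
    by_cases h17 : i < 17
    · simpa [h17] using congrArg (BitVec.getLsbD · i) hlow
    by_cases h32 : i < 32
    · have h := congrArg (BitVec.getLsbD · (i - 24)) hhigh
      simpa [show i - 24 < 8 by lia, show 24 + (i - 24) = i by lia] using h
    · rw [BitVec.getLsbD_of_ge x i (by lia), BitVec.getLsbD_of_ge y i (by lia)]
  have hlow7 : x.setWidth 7 = y.setWidth 7 := by
    refine BitVec.eq_of_getLsbD_eq fun i hi => ?_
    simp [hi, hxy i (by lia)]
  rw [BitVec.setWidth_add _ _ (by lia), BitVec.setWidth_add _ _ (by lia), hlow7,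
    BitVec.add_right_inj] at hout
  refine eq_of_T_low_bits_eq hxy fun i hi => ?_
  simpa [hi] using congrArg (BitVec.getLsbD · i) hout

theorem splitOutput_bijective : Function.Bijective splitOutput := by
  rw [Fintype.bijective_iff_injective_and_card]
  refine ⟨splitOutput_injective, ?_⟩
  rw [Fintype.ofEquiv_card, Fintype.card_prod, Fintype.card_prod]
  simp only [Fintype.card_fin]
  norm_num

theorem and_127_eq_iff {z r : BitVec 32} (hr : r < 128) :
    z &&& 127 = r ↔ (z.setWidth 7).toFin = (r.setWidth 7).toFin := by
  have hr' : r.toNat < 128 := hr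
  have hz : (z &&& 127).toNat = z.toNat % 2 ^ 7 := by
    rw [BitVec.toNat_and]
    exact Nat.and_two_pow_sub_one_eq_mod z.toNat 7
  rw [BitVec.toFin_inj, ← BitVec.toNat_inj, ← BitVec.toNat_inj, hz, BitVec.toNat_setWidth,
    BitVec.toNat_setWidth, Nat.mod_eq_of_lt (a := r.toNat) (by lia)]

/-- The seven least significant bits of the SHR3 output `x + T x` are exactly
uniformly distributed: every residue `r < 128` is attained by exactly `2^25`
words `x`. -/
theorem shr3_output_low_bits_uniform (r : BitVec 32) (hr : r < 128) :
    (Finset.univ.filter fun x : BitVec 32 => (x + T x) &&& 127 = r).card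
      = 2 ^ 25 := by
  have hcard : (Finset.univ.filter fun x : BitVec 32 => (x + T x) &&& 127 = r).card =
      ((Finset.univ : Finset (Fin (2 ^ 8) × Fin (2 ^ 17))) ×ˢ {(r.setWidth 7).toFin}).card := by
    refine Finset.card_bijective splitOutput splitOutput_bijective fun x => ?_
    simp only [Finset.mem_filter, Finset.mem_univ, true_and, Finset.mem_product,
      Finset.mem_singleton]
    exact and_127_eq_iff hr
  rw [hcard, Finset.card_product, Finset.card_univ, Fintype.card_prod, Fintype.card_fin,
    Fintype.card_fin, Finset.card_singleton]
  norm_num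
end

section
/- The combined state-update of the uniform PRNG underlying Matlab's randn has period 2^32·(2^32 − 1): for every nonzero 32-bit word j (the jsr register) and every element b of ZMod 2^32 (the icng register), the least positive integer n such that T^[n](j) = j and R^[n](b) = b is 2^32·(2^32 − 1). -/
/-- The congruential register update `icng = 69069*icng + 1234567`. -/
def R (x : ZMod (2 ^ 32)) : ZMod (2 ^ 32) := 69069 * x + 1234567

theorem T_xor (x y : BitVec 32) : T (x ^^^ y) = T x ^^^ T y := by
  have left (n : ℕ) (x y : BitVec 32) :
      (x ^^^ y) ^^^ ((x ^^^ y) <<< n) = (x ^^^ (x <<< n)) ^^^ (y ^^^ (y <<< n)) := by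
    rw [BitVec.shiftLeft_xor_distrib]
    ac_rfl
  have right (n : ℕ) (x y : BitVec 32) :
      (x ^^^ y) ^^^ ((x ^^^ y) >>> n) = (x ^^^ (x >>> n)) ^^^ (y ^^^ (y >>> n)) := by
    rw [BitVec.ushiftRight_xor_distrib]
    ac_rfl
  unfold T
  dsimp only
  rw [left 13, right 17, left 5]

theorem T_zero : T 0 = 0 := by decide

theorem Nat.xor_two_pow_lt {n x : ℕ} (h₁ : 2 ^ n ≤ x) (h₂ : x < 2 ^ (n + 1)) :
    x ^^^ 2 ^ n < 2 ^ n := by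
  have hx : x / 2 ^ n = 1 := by
    apply Nat.div_eq_of_lt_le <;> omega
  have h : (x ^^^ 2 ^ n) / 2 ^ n = 0 := by
    rw [Nat.xor_div_two_pow, hx, Nat.div_self (by positivity), Nat.xor_self]
  exact (Nat.div_eq_zero_iff_lt (by positivity)).mp h

/-- An additive map on 32-bit words that vanishes on the powers of two vanishes. -/
theorem BitVec.eq_zero_of_additive {f : BitVec 32 → BitVec 32}
    (hf : ∀ x y, f (x ^^^ y) = f x ^^^ f y) (h : ∀ i < 32, f (BitVec.ofNat 32 (2 ^ i)) = 0)
    (v : BitVec 32) : f v = 0 := by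
  have h_zero : f 0 = 0 := by simpa using hf 0 0
  have key : ∀ n ≤ 32, ∀ x < 2 ^ n, f (BitVec.ofNat 32 x) = 0 := by
    intro n
    induction n with
    | zero =>
      intro _ x hx
      obtain rfl : x = 0 := by omega
      exact h_zero
    | succ n ih =>
      intro hn x hx
      rcases lt_or_ge x (2 ^ n) with hlt | hge
      · exact ih (by omega) x hlt
      · have hsplit : x = (x ^^^ 2 ^ n) ^^^ 2 ^ n := by simp
        rw [hsplit, BitVec.ofNat_xor, hf, h n (by omega),
          ih (by omega) _ (Nat.xor_two_pow_lt hge hx)]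
        rfl
  simpa using key 32 le_rfl v.toNat v.isLt

/-- The bits of `a` below position `k`, read as the coefficients of a polynomial over the field
with two elements, evaluated at `T` and applied to `v`. -/
def evalT : ℕ → ℕ → BitVec 32 → BitVec 32
  | 0, _, _ => 0
  | k + 1, a, v => (if a % 2 = 1 then v else 0) ^^^ T (evalT k (a / 2) v)

theorem evalT_xor (k a b : ℕ) (v : BitVec 32) :
    evalT k (a ^^^ b) v = evalT k a v ^^^ evalT k b v := by
  induction k generalizing a b with
  | zero => simp [evalT]
  | succ k ih =>
    simp only [evalT, Nat.xor_div_two, ih, T_xor, Nat.xor_mod_two_eq_one]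
    rcases Nat.mod_two_eq_zero_or_one a with ha | ha <;>
      rcases Nat.mod_two_eq_zero_or_one b with hb | hb <;> simp [ha, hb]
    · ac_rfl
    · ac_rfl
    · rw [show ∀ s t : BitVec 32, v ^^^ s ^^^ (v ^^^ t) = (v ^^^ v) ^^^ (s ^^^ t) by
        intros; ac_rfl]
      simp

theorem evalT_apply_xor (k a : ℕ) (v w : BitVec 32) :
    evalT k a (v ^^^ w) = evalT k a v ^^^ evalT k a w := by
  induction k generalizing a with
  | zero => simp [evalT]
  | succ k ih =>
    simp only [evalT, ih, T_xor]
    split_ifs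
    · ac_rfl
    · simp

theorem evalT_apply_zero (k a : ℕ) : evalT k a 0 = 0 := by
  simpa using evalT_apply_xor k a 0 0

theorem evalT_apply_T (k a : ℕ) (v : BitVec 32) : evalT k a (T v) = T (evalT k a v) := by
  induction k generalizing a with
  | zero => exact T_zero.symm
  | succ k ih =>
    simp only [evalT, ih, T_xor]
    split_ifs
    · rfl
    · rw [T_zero]

theorem evalT_zero (k : ℕ) (v : BitVec 32) : evalT k 0 v = 0 := by
  simpa using evalT_xor k 0 0 v

theorem evalT_one (k : ℕ) (v : BitVec 32) : evalT (k + 1) 1 v = v := by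
  simp only [evalT, Nat.reduceDiv, evalT_zero, T_zero]
  simp

theorem evalT_succ {k a : ℕ} (ha : a < 2 ^ k) (v : BitVec 32) :
    evalT (k + 1) a v = evalT k a v := by
  induction k generalizing a with
  | zero =>
    obtain rfl : a = 0 := by omega
    rw [evalT_zero, evalT_zero]
  | succ k ih =>
    rw [evalT, ih (by omega), evalT]

theorem evalT_two_mul {k a : ℕ} (ha : a < 2 ^ k) (v : BitVec 32) :
    evalT (k + 1) (2 * a) v = T (evalT (k + 1) a v) := by
  rw [evalT_succ ha, evalT]
  simp

/-- The coefficients of the remainder of `X ^ 32` modulo the characteristic polynomial of `T`. -/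
def charPolyTail : ℕ := 4112961

theorem T_evalT_two_pow (v : BitVec 32) : T (evalT 32 (2 ^ 31) v) = evalT 32 charPolyTail v := by
  have h := BitVec.eq_zero_of_additive
    (f := fun v => T (evalT 32 (2 ^ 31) v) ^^^ evalT 32 charPolyTail v)
    (fun x y => by simp only [evalT_apply_xor, T_xor]; ac_rfl) (by decide +kernel) v
  exact BitVec.xor_eq_zero_iff.mp h

/-- Multiplication by `X` modulo the characteristic polynomial of `T`. -/
def mulX (a : ℕ) : ℕ :=
  if a < 2 ^ 31 then 2 * a else 2 * (a ^^^ 2 ^ 31) ^^^ charPolyTail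

theorem mulX_lt {a : ℕ} (ha : a < 2 ^ 32) : mulX a < 2 ^ 32 := by
  unfold mulX
  split_ifs with h
  · omega
  · have := Nat.xor_two_pow_lt (not_lt.mp h) ha
    exact Nat.xor_lt_two_pow (by omega) (by norm_num [charPolyTail])

theorem evalT_mulX {a : ℕ} (ha : a < 2 ^ 32) (v : BitVec 32) :
    evalT 32 (mulX a) v = T (evalT 32 a v) := by
  unfold mulX
  split_ifs with h
  · exact evalT_two_mul h v
  · have hsplit : a = (a ^^^ 2 ^ 31) ^^^ 2 ^ 31 := by simp
    conv_rhs => rw [hsplit]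
    rw [evalT_xor, evalT_xor, evalT_two_mul (Nat.xor_two_pow_lt (not_lt.mp h) ha), T_xor,
      T_evalT_two_pow]

/-- The product of `a` and the lowest `k` bits of `b` modulo the characteristic polynomial
of `T`. -/
def mulPoly : ℕ → ℕ → ℕ → ℕ
  | 0, _, _ => 0
  | k + 1, a, b => (if b % 2 = 1 then a else 0) ^^^ mulX (mulPoly k a (b / 2))

theorem mulPoly_lt (k : ℕ) {a : ℕ} (b : ℕ) (ha : a < 2 ^ 32) : mulPoly k a b < 2 ^ 32 := by
  induction k generalizing b with
  | zero => simp [mulPoly]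
  | succ k ih =>
    refine Nat.xor_lt_two_pow ?_ (mulX_lt (ih _))
    split_ifs
    · exact ha
    · norm_num

theorem evalT_mulPoly (k : ℕ) {a : ℕ} (b : ℕ) (ha : a < 2 ^ 32) (v : BitVec 32) :
    evalT 32 (mulPoly k a b) v = evalT k b (evalT 32 a v) := by
  induction k generalizing b with
  | zero => exact evalT_zero 32 v
  | succ k ih =>
    rw [mulPoly, evalT_xor, evalT_mulX (mulPoly_lt k _ ha), ih,
      apply_ite (evalT 32 · v), evalT_zero]
    rfl

/-- The power `X ^ n` modulo the characteristic polynomial of `T`, for `n < 2 ^ k`. -/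
def powX : ℕ → ℕ → ℕ
  | 0, _ => 1
  | k + 1, n =>
    let s := mulPoly 32 (powX k (n / 2)) (powX k (n / 2))
    if n % 2 = 1 then mulX s else s

theorem powX_lt (k n : ℕ) : powX k n < 2 ^ 32 := by
  induction k generalizing n with
  | zero => norm_num [powX]
  | succ k ih =>
    have := mulPoly_lt 32 (powX k (n / 2)) (ih (n / 2))
    simp only [powX]
    split_ifs
    · exact mulX_lt this
    · exact this

theorem evalT_powX {k n : ℕ} (hn : n < 2 ^ k) (v : BitVec 32) :
    evalT 32 (powX k n) v = T^[n] v := by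
  induction k generalizing n v with
  | zero =>
    obtain rfl : n = 0 := by omega
    exact evalT_one 31 v
  | succ k ih =>
    have hlt := powX_lt k (n / 2)
    have hs : evalT 32 (mulPoly 32 (powX k (n / 2)) (powX k (n / 2))) v =
        T^[n / 2 + n / 2] v := by
      rw [evalT_mulPoly 32 _ hlt, ih (by omega), ih (by omega), Function.iterate_add_apply]
    simp only [powX]
    split_ifs with h
    · rw [evalT_mulX (mulPoly_lt 32 _ hlt), hs, ← Function.iterate_succ_apply' T]
      congr 2
      omega
    · rw [hs]
      congr 2
      omega

theorem T_iterate_eq_self (j : BitVec 32) : T^[2 ^ 32 - 1] j = j := by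
  have h : powX 32 (2 ^ 32 - 1) = 1 := by decide +kernel
  rw [← evalT_powX (k := 32) (by norm_num), h, evalT_one]

/-- If `X ^ n - 1` is invertible modulo the characteristic polynomial of `T`, then `T^[n]` fixes
only zero. -/
theorem eq_zero_of_T_iterate_eq_self {n : ℕ} (u : ℕ) (hn : n < 2 ^ 32)
    (hu : mulPoly 32 (powX 32 n ^^^ 1) u = 1) {j : BitVec 32} (hj : T^[n] j = j) : j = 0 := by
  have h := evalT_mulPoly 32 u
    (Nat.xor_lt_two_pow (powX_lt 32 n) (show 1 < 2 ^ 32 by norm_num)) j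
  rw [hu, evalT_one, evalT_xor, evalT_powX hn, hj, evalT_one, BitVec.xor_self] at h
  exact h.trans (evalT_apply_zero 32 u)

theorem minimalPeriod_T {j : BitVec 32} (hj : j ≠ 0) :
    Function.minimalPeriod T j = 2 ^ 32 - 1 := by
  have hper : Function.IsPeriodicPt T (2 ^ 32 - 1) j := T_iterate_eq_self j
  obtain ⟨q, hq⟩ := hper.minimalPeriod_dvd
  by_contra hne
  have hq1 : q ≠ 1 := by
    rintro rfl
    exact hne (by rw [hq, mul_one])
  obtain ⟨p, hp, r, rfl⟩ := Nat.exists_prime_and_dvd hq1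
  have hfix : ∀ n, p * n = 2 ^ 32 - 1 → T^[n] j = j := by
    intro n hn
    have hdvd : Function.minimalPeriod T j ∣ n :=
      ⟨r, Nat.eq_of_mul_eq_mul_left hp.pos (by rw [hn, hq]; ring)⟩
    exact Function.isPeriodicPt_iff_minimalPeriod_dvd.mpr hdvd
  have hdvd : p ∣ 3 * 5 * 17 * 257 * 65537 := by
    have h : p ∣ 2 ^ 32 - 1 := hq ▸ (Dvd.intro r rfl).mul_left _
    exact h
  simp only [hp.dvd_mul, Nat.prime_dvd_prime_iff_eq hp (show Nat.Prime 3 by norm_num),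
    Nat.prime_dvd_prime_iff_eq hp (show Nat.Prime 5 by norm_num),
    Nat.prime_dvd_prime_iff_eq hp (show Nat.Prime 17 by norm_num),
    Nat.prime_dvd_prime_iff_eq hp (show Nat.Prime 257 by norm_num),
    Nat.prime_dvd_prime_iff_eq hp (show Nat.Prime 65537 by norm_num)] at hdvd
  apply hj
  rcases hdvd with (((rfl | rfl) | rfl) | rfl) | rfl
  · exact eq_zero_of_T_iterate_eq_self (n := 1431655765) 2585467165 (by norm_num)
      (by decide +kernel) (hfix _ (by norm_num))
  · exact eq_zero_of_T_iterate_eq_self (n := 858993459) 627944065 (by norm_num)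
      (by decide +kernel) (hfix _ (by norm_num))
  · exact eq_zero_of_T_iterate_eq_self (n := 252645135) 1428936566 (by norm_num)
      (by decide +kernel) (hfix _ (by norm_num))
  · exact eq_zero_of_T_iterate_eq_self (n := 16711935) 2895861762 (by norm_num)
      (by decide +kernel) (hfix _ (by norm_num))
  · exact eq_zero_of_T_iterate_eq_self (n := 65535) 3511099410 (by norm_num)
      (by decide +kernel) (hfix _ (by norm_num))

theorem R_iterate_intCast (b : ℤ) (n : ℕ) :
    R^[n] (b : ZMod (2 ^ 32)) =
      ((b + (∑ i ∈ Finset.range n, 69069 ^ i) * (69068 * b + 1234567) : ℤ) : ZMod (2 ^ 32)) := by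
  induction n with
  | zero => simp
  | succ n ih =>
    have hgeom := geom_sum_mul (69069 : ℤ) n
    have h : b + (∑ i ∈ Finset.range (n + 1), 69069 ^ i) * (69068 * b + 1234567) =
        69069 * (b + (∑ i ∈ Finset.range n, 69069 ^ i) * (69068 * b + 1234567)) + 1234567 := by
      rw [Finset.sum_range_succ]
      linear_combination -(69068 * b + 1234567) * hgeom
    rw [Function.iterate_succ_apply', ih, h, R]
    push_cast
    rfl

theorem two_pow_dvd_geom_sum_iff (n : ℕ) :
    (2 : ℤ) ^ 32 ∣ ∑ i ∈ Finset.range n, (69069 : ℤ) ^ i ↔ 2 ^ 32 ∣ n := by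
  have hlte := Int.two_pow_sub_pow' (x := 69069) (y := 1) n (by norm_num) (by norm_num)
  rw [one_pow, ← geom_sum_mul, emultiplicity_mul Int.prime_two, add_comm] at hlte
  have hfin : emultiplicity (2 : ℤ) (69069 - 1) ≠ ⊤ :=
    finiteMultiplicity_iff_emultiplicity_ne_top.mp
      (Int.finiteMultiplicity_iff.mpr ⟨by norm_num, by norm_num⟩)
  have h := ENat.add_right_injective_of_ne_top hfin hlte
  rw [pow_dvd_iff_le_emultiplicity, h, ← pow_dvd_iff_le_emultiplicity]
  exact_mod_cast Int.natCast_dvd_natCast (m := 2 ^ 32) (n := n)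

theorem R_iterate_eq_self_iff (b : ZMod (2 ^ 32)) (n : ℕ) : R^[n] b = b ↔ 2 ^ 32 ∣ n := by
  obtain ⟨b, rfl⟩ := ZMod.intCast_surjective b
  have hcop : IsCoprime ((2 : ℤ) ^ 32) (69068 * b + 1234567) :=
    IsCoprime.pow_left ⟨-(34534 * b + 617283), 1, by ring⟩
  rw [R_iterate_intCast, Int.cast_add, add_eq_left, ZMod.intCast_zmod_eq_zero_iff_dvd,
    ← two_pow_dvd_geom_sum_iff]
  push_cast
  exact ⟨hcop.dvd_of_dvd_mul_right, fun h => h.mul_right _⟩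

/-- The combined state-update of the uniform PRNG underlying Matlab's `randn`
has period `2^32 * (2^32 - 1)`: for every nonzero 32-bit word `j` and every
`b : ZMod 2^32`, the least positive integer `n` with `T^[n] j = j` and
`R^[n] b = b` is `2^32 * (2^32 - 1)`. -/
theorem randn_prng_combined_period (j : BitVec 32) (hj : j ≠ 0)
    (b : ZMod (2 ^ 32)) :
    IsLeast {n : ℕ | 0 < n ∧ T^[n] j = j ∧ R^[n] b = b}
      (2 ^ 32 * (2 ^ 32 - 1)) := by
  have hT : ∀ n, T^[n] j = j ↔ 2 ^ 32 - 1 ∣ n := fun n => by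
    rw [← minimalPeriod_T hj]
    exact Function.isPeriodicPt_iff_minimalPeriod_dvd
  simp only [hT, R_iterate_eq_self_iff]
  refine ⟨⟨by norm_num, Dvd.intro_left _ rfl, Dvd.intro _ rfl⟩, ?_⟩
  rintro n ⟨hpos, hTn, hRn⟩
  exact Nat.le_of_dvd hpos (Nat.Coprime.mul_dvd_of_dvd_of_dvd (by norm_num) hRn hTn)
end

section
/- Every non-trivial state of the multiply-with-carry generator with multiplier a = 18000 and base b = 2^16 has period exactly 589823999: for every state (c, w) with c < 18000 and w < 2^16, other than (0, 0) and (17999, 65535), the least positive integer n such that the n-fold iterate F^[n](c, w) equals (c, w) is 589823999 = (18000·2^16 − 2)/2. -/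
/-- The transition function of the multiply-with-carry generator with
multiplier `a` and base `2^16`. -/
def F (a : ℕ) (s : ℕ × ℕ) : ℕ × ℕ := ((s.1 + a * s.2) / 2 ^ 16, (s.1 + a * s.2) % 2 ^ 16)

/-- The integer `c + a * w` attached to the state `(c, w)`. -/
def stateValue (a : ℕ) (s : ℕ × ℕ) : ℕ := s.1 + a * s.2

/-- A state `(c, w)` with `c < a` and `w < 2 ^ 16`. -/
def IsState (a : ℕ) (s : ℕ × ℕ) : Prop := s.1 < a ∧ s.2 < 2 ^ 16

theorem IsState.stateValue_lt {a : ℕ} {s : ℕ × ℕ} (hs : IsState a s) :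
    stateValue a s < a * 2 ^ 16 := by
  obtain ⟨h1, h2⟩ := hs
  have := Nat.mul_le_mul_left a (Nat.succ_le_of_lt h2)
  rw [Nat.succ_eq_add_one, mul_add, mul_one] at this
  unfold stateValue
  omega

theorem IsState.map_F {a : ℕ} {s : ℕ × ℕ} (hs : IsState a s) : IsState a (F a s) :=
  ⟨Nat.div_lt_of_lt_mul (hs.stateValue_lt.trans_eq (mul_comm _ _)), Nat.mod_lt _ (by norm_num)⟩

theorem IsState.iterate_F {a : ℕ} {s : ℕ × ℕ} (hs : IsState a s) (n : ℕ) :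
    IsState a ((F a)^[n] s) := by
  induction n with
  | zero => exact hs
  | succ n ih => rw [Function.iterate_succ_apply']; exact ih.map_F

theorem IsState.eq_of_stateValue_eq {a : ℕ} {s t : ℕ × ℕ} (hs : IsState a s) (ht : IsState a t)
    (h : stateValue a s = stateValue a t) : s = t := by
  have h1 : s.1 = t.1 := by
    simpa [stateValue, Nat.mod_eq_of_lt hs.1, Nat.mod_eq_of_lt ht.1] using congrArg (· % a) h
  have h2 : a * s.2 = a * t.2 := by unfold stateValue at h; omega
  exact Prod.ext h1 (Nat.eq_of_mul_eq_mul_left (Nat.zero_lt_of_lt hs.1) h2)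

/-- Modulo `m = a * 2 ^ 16 - 1`, the generator multiplies the state value by `a`. -/
theorem stateValue_F {a m : ℕ} (hm : m + 1 = a * 2 ^ 16) (s : ℕ × ℕ) :
    (stateValue a (F a s) : ZMod m) = a * stateValue a s := by
  have hdiv : 2 ^ 16 * (F a s).1 + (F a s).2 = stateValue a s := Nat.div_add_mod _ _
  have hone : (a : ZMod m) * 2 ^ 16 = 1 := by
    have h := congrArg (Nat.cast (R := ZMod m)) hm
    rw [Nat.cast_mul, Nat.cast_pow, Nat.cast_ofNat, Nat.cast_add, ZMod.natCast_self, zero_add,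
      Nat.cast_one] at h
    exact h.symm
  rw [← hdiv]
  simp only [stateValue]
  push_cast
  linear_combination -((F a s).1 : ZMod m) * hone

theorem stateValue_iterate_F {a m : ℕ} (hm : m + 1 = a * 2 ^ 16) (s : ℕ × ℕ) (n : ℕ) :
    (stateValue a ((F a)^[n] s) : ZMod m) = a ^ n * stateValue a s := by
  induction n with
  | zero => simp
  | succ n ih => rw [Function.iterate_succ_apply', stateValue_F hm, ih]; ring

/-- Only the two trivial states have value divisible by `m = a * 2 ^ 16 - 1`. -/
theorem IsState.stateValue_cast_ne_zero {a m : ℕ} (hm : m + 1 = a * 2 ^ 16) {s : ℕ × ℕ}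
    (hs : IsState a s) (h0 : s ≠ (0, 0)) (h1 : s ≠ (a - 1, 2 ^ 16 - 1)) :
    (stateValue a s : ZMod m) ≠ 0 := by
  have ha := Nat.zero_lt_of_lt hs.1
  rw [Ne, ZMod.natCast_eq_zero_iff]
  rintro ⟨k, hk⟩
  have hlt := hs.stateValue_lt
  have hk2 : k < 2 := by
    by_contra! h
    have := Nat.mul_le_mul_left m h
    omega
  interval_cases k
  · exact h0 (hs.eq_of_stateValue_eq ⟨ha, by norm_num⟩ (by simpa [stateValue] using hk))
  · refine h1 (hs.eq_of_stateValue_eq ⟨Nat.sub_lt ha one_pos, by norm_num⟩ ?_)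
    rw [hk]
    simp only [stateValue]
    omega

theorem IsState.iterate_F_eq_iff {a m : ℕ} [Fact m.Prime] (hm : m + 1 = a * 2 ^ 16) {s : ℕ × ℕ}
    (hs : IsState a s) (h0 : s ≠ (0, 0)) (h1 : s ≠ (a - 1, 2 ^ 16 - 1)) (n : ℕ) :
    (F a)^[n] s = s ↔ (a : ZMod m) ^ n = 1 := by
  have hne := hs.stateValue_cast_ne_zero hm h0 h1
  have hiter := stateValue_iterate_F hm s n
  constructor
  · intro h
    rw [h] at hiter
    exact mul_right_cancel₀ hne (by rw [one_mul, ← hiter])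
  · intro h
    rw [h, one_mul] at hiter
    have hlt {t : ℕ × ℕ} (ht : IsState a t) (h : (stateValue a t : ZMod m) ≠ 0) :
        stateValue a t < m := by
      have := ht.stateValue_lt
      refine lt_of_le_of_ne (by omega) fun h' => h ?_
      rw [h', ZMod.natCast_self]
    have hs' := hs.iterate_F n
    refine hs'.eq_of_stateValue_eq hs ?_
    have hmod := (ZMod.natCast_eq_natCast_iff' _ _ m).1 hiter
    rwa [Nat.mod_eq_of_lt (hlt hs' (hiter ▸ hne)), Nat.mod_eq_of_lt (hlt hs hne)] at hmod

theorem zmod_ofNat_ne_one {p k : ℕ} [k.AtLeastTwo] (h : k < p) :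
    (OfNat.ofNat k : ZMod p) ≠ 1 := by
  have hk := Nat.AtLeastTwo.prop (n := k)
  rw [← Nat.cast_ofNat, ← Nat.cast_one, Ne, ZMod.natCast_eq_natCast_iff']
  change k % p ≠ 1 % p
  rw [Nat.mod_eq_of_lt h, Nat.mod_eq_of_lt (by omega)]
  omega

theorem prime_294911999 : Nat.Prime 294911999 := by
  refine lucas_primality _ 7 (by reduce_mod_char) fun q hq hqd => ?_
  rw [show 294911999 - 1 = 2 * (1399 * 105401) by norm_num, hq.dvd_mul, hq.dvd_mul,
    Nat.prime_dvd_prime_iff_eq hq (by norm_num), Nat.prime_dvd_prime_iff_eq hq (by norm_num),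
    Nat.prime_dvd_prime_iff_eq hq (by norm_num)] at hqd
  rcases hqd with rfl | rfl | rfl <;> reduce_mod_char <;>
    exact zmod_ofNat_ne_one (by norm_num)

theorem prime_589823999 : Nat.Prime 589823999 := by
  refine lucas_primality _ 7 (by reduce_mod_char) fun q hq hqd => ?_
  rw [show 589823999 - 1 = 2 * 294911999 by norm_num, hq.dvd_mul,
    Nat.prime_dvd_prime_iff_eq hq Nat.prime_two,
    Nat.prime_dvd_prime_iff_eq hq prime_294911999] at hqd
  rcases hqd with rfl | rfl <;> reduce_mod_char <;>
    exact zmod_ofNat_ne_one (by norm_num)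

theorem prime_1179647999 : Nat.Prime 1179647999 := by
  refine lucas_primality _ 31 (by reduce_mod_char) fun q hq hqd => ?_
  rw [show 1179647999 - 1 = 2 * 589823999 by norm_num, hq.dvd_mul,
    Nat.prime_dvd_prime_iff_eq hq Nat.prime_two,
    Nat.prime_dvd_prime_iff_eq hq prime_589823999] at hqd
  rcases hqd with rfl | rfl <;> reduce_mod_char <;>
    exact zmod_ofNat_ne_one (by norm_num)

theorem orderOf_18000 : orderOf (18000 : ZMod 1179647999) = 589823999 := by
  have : Fact (Nat.Prime 589823999) := ⟨prime_589823999⟩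
  exact orderOf_eq_prime (by reduce_mod_char) (zmod_ofNat_ne_one (by norm_num))

/-- Every non-trivial state of the MWC generator with multiplier 18000 has
period exactly `589823999 = (18000 * 2^16 - 2) / 2`. -/
theorem mwc18000_period (c w : ℕ) (hc : c < 18000) (hw : w < 2 ^ 16)
    (h0 : (c, w) ≠ (0, 0)) (h1 : (c, w) ≠ (17999, 65535)) :
    IsLeast {n : ℕ | 0 < n ∧ (F 18000)^[n] (c, w) = (c, w)}
      ((18000 * 2 ^ 16 - 2) / 2) ∧ (18000 * 2 ^ 16 - 2) / 2 = 589823999 := by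
  have : Fact (Nat.Prime 1179647999) := ⟨prime_1179647999⟩
  have hiter (n : ℕ) : (F 18000)^[n] (c, w) = (c, w) ↔ 589823999 ∣ n := by
    rw [IsState.iterate_F_eq_iff (m := 1179647999) (by norm_num) ⟨hc, hw⟩ h0 h1, Nat.cast_ofNat,
      ← orderOf_dvd_iff_pow_eq_one, orderOf_18000]
  have hperiod : (18000 * 2 ^ 16 - 2) / 2 = 589823999 := by norm_num
  refine ⟨?_, hperiod⟩
  rw [hperiod]
  exact ⟨⟨by norm_num, (hiter _).2 dvd_rfl⟩, fun n hn => Nat.le_of_dvd hn.1 ((hiter n).1 hn.2)⟩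
end

section
/- The non-trivial states of the multiply-with-carry generator with multiplier a = 18000 and base b = 2^16 form exactly two disjoint orbits under the transition map F, each of size 589823999: there exist states s₁ and s₂, neither equal to (0,0) nor (17999, 65535), such that the orbits {F^[n](s₁) : n ∈ ℕ} and {F^[n](s₂) : n ∈ ℕ} are disjoint, each has cardinality 589823999, and their union is the set of all states (c, w) with c < 18000, w < 2^16 other than (0,0) and (17999, 65535). -/
theorem prime_two_mul_add_one {r : ℕ} (hr : r.Prime) (a : ZMod (2 * r + 1))
    (h : a ^ (2 * r) = 1) (h_two : a ^ r ≠ 1) (hr_ne : a ^ 2 ≠ 1) : (2 * r + 1).Prime := by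
  refine lucas_primality _ a (by simpa using h) fun q hq hdvd => ?_
  rw [Nat.add_sub_cancel] at hdvd ⊢
  rcases (Nat.Prime.dvd_mul hq).1 hdvd with hd | hd
  · obtain rfl := (Nat.prime_dvd_prime_iff_eq hq Nat.prime_two).1 hd
    rwa [Nat.mul_div_cancel_left _ two_pos]
  · obtain rfl := (Nat.prime_dvd_prime_iff_eq hq hr).1 hd
    rwa [Nat.mul_div_cancel _ hr.pos]

instance : Fact (Nat.Prime 1179647999) := ⟨prime_1179647999⟩

/-- The unit `18000` of the field with `18000 * 2 ^ 16 - 1` elements. -/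
noncomputable def multiplier : (ZMod 1179647999)ˣ :=
  ZMod.unitOfCoprime 18000 (by norm_num)

theorem orderOf_multiplier : orderOf multiplier = 589823999 := by
  have : Fact (Nat.Prime 589823999) := ⟨prime_589823999⟩
  refine orderOf_eq_prime ?_ ?_
  · ext
    simp only [multiplier, Units.val_pow_eq_pow_val, ZMod.coe_unitOfCoprime, Units.val_one,
      Nat.cast_ofNat]
    reduce_mod_char
  · intro h
    have h' : ((18000 : ℕ) : ZMod 1179647999) = (1 : ℕ) := by
      simpa only [multiplier, ZMod.coe_unitOfCoprime, Units.val_one, Nat.cast_one] using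
        congrArg Units.val h
    rw [ZMod.natCast_eq_natCast_iff] at h'
    change 18000 % 1179647999 = 1 % 1179647999 at h'
    norm_num at h'

/-- The generator state `(c, w)` whose value `c + 18000 * w` represents the given unit. -/
def state (x : (ZMod 1179647999)ˣ) : ℕ × ℕ :=
  ((x : ZMod 1179647999).val % 18000, (x : ZMod 1179647999).val / 18000)

theorem val_unit_pos (x : (ZMod 1179647999)ˣ) : 0 < (x : ZMod 1179647999).val :=
  Nat.pos_of_ne_zero fun h => x.ne_zero ((ZMod.val_eq_zero _).1 h)

theorem state_injective : Function.Injective state := by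
  intro x y h
  simp only [state, Prod.mk.injEq] at h
  exact Units.ext (ZMod.val_injective _ (by omega))

theorem F_state (x : (ZMod 1179647999)ˣ) : F 18000 (state x) = state (multiplier * x) := by
  have hx := val_unit_pos x
  have hlt := ZMod.val_lt (x : ZMod 1179647999)
  have hval : ((multiplier * x : (ZMod 1179647999)ˣ) : ZMod 1179647999).val =
      18000 * (x : ZMod 1179647999).val % 1179647999 := by
    rw [Units.val_mul, ZMod.val_mul, multiplier, ZMod.coe_unitOfCoprime, ZMod.val_natCast]
  simp only [F, state, hval, Prod.mk.injEq]
  generalize (x : ZMod 1179647999).val = t at *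
  have hmod : 18000 * t % 1179647999 = t / 2 ^ 16 + 18000 * (t % 2 ^ 16) := by
    rw [show 18000 * t = t / 2 ^ 16 + 18000 * (t % 2 ^ 16) + 1179647999 * (t / 2 ^ 16) by omega,
      Nat.add_mul_mod_self_left, Nat.mod_eq_of_lt (by omega)]
  rw [Nat.mod_add_div, hmod]
  omega

theorem F_iterate_state (n : ℕ) (x : (ZMod 1179647999)ˣ) :
    (F 18000)^[n] (state x) = state (multiplier ^ n * x) := by
  induction n with
  | zero => simp
  | succ n ih => rw [Function.iterate_succ_apply', ih, F_state, pow_succ', mul_assoc]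

theorem range_state :
    Set.range state =
      {p : ℕ × ℕ | p.1 < 18000 ∧ p.2 < 2 ^ 16} \ {(0, 0), (17999, 65535)} := by
  ext ⟨c, w⟩
  simp only [Set.mem_range, Set.mem_sdiff, Set.mem_ofPred_eq, Set.mem_insert_iff,
    Set.mem_singleton_iff, Prod.mk.injEq]
  constructor
  · rintro ⟨x, hx⟩
    have hpos := val_unit_pos x
    have hlt := ZMod.val_lt (x : ZMod 1179647999)
    simp only [state, Prod.mk.injEq] at hx
    omega
  · rintro ⟨⟨hc, hw⟩, h⟩
    have hval : ((c + 18000 * w : ℕ) : ZMod 1179647999).val = c + 18000 * w :=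
      ZMod.val_cast_of_lt (by omega)
    have hne : ((c + 18000 * w : ℕ) : ZMod 1179647999) ≠ 0 := by
      intro h0
      rw [h0, ZMod.val_zero] at hval
      omega
    refine ⟨Units.mk0 _ hne, ?_⟩
    simp only [state, Units.val_mk0, hval, Prod.mk.injEq]
    omega

theorem range_iterate_state (x : (ZMod 1179647999)ˣ) :
    (Set.range fun n : ℕ => (F 18000)^[n] (state x)) =
      state '' Set.range fun n : ℕ => multiplier ^ n * x := by
  simp only [F_iterate_state, ← Set.range_comp, Function.comp_def]

theorem ncard_range_pow_mul (x : (ZMod 1179647999)ˣ) :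
    (Set.range fun n : ℕ => multiplier ^ n * x).ncard = 589823999 := by
  have h : (Set.range fun n : ℕ => multiplier ^ n * x) =
      (· * x) '' (Submonoid.powers multiplier : Set (ZMod 1179647999)ˣ) := by
    rw [Submonoid.coe_powers, ← Set.range_comp]
    rfl
  rw [h, Set.ncard_image_of_injective _ (mul_left_injective x), ← orderOf_multiplier,
    ← Nat.card_submonoidPowers]
  rfl

theorem disjoint_range_pow_mul :
    Disjoint (Set.range fun n : ℕ => multiplier ^ n * 1)
      (Set.range fun n : ℕ => multiplier ^ n * -1) := by
  rw [Set.disjoint_left]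
  rintro _ ⟨n, rfl⟩ ⟨k, hk⟩
  have hpow (j : ℕ) : (multiplier ^ j) ^ 589823999 = 1 := by
    rw [pow_right_comm, ← orderOf_multiplier, pow_orderOf_eq_one, one_pow]
  have h := congrArg (· ^ 589823999) hk
  simp only [mul_pow, hpow, one_mul, one_pow] at h
  rw [Odd.neg_one_pow (by decide)] at h
  have : Fact (2 < 1179647999) := ⟨by norm_num⟩
  exact ZMod.neg_one_ne_one (n := 1179647999) (by simpa using congrArg Units.val h)

theorem range_pow_mul_union :
    (Set.range fun n : ℕ => multiplier ^ n * 1) ∪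
      (Set.range fun n : ℕ => multiplier ^ n * -1) = Set.univ := by
  refine Set.eq_of_subset_of_ncard_le (Set.subset_univ _) ?_ Set.finite_univ
  rw [Set.ncard_union_eq disjoint_range_pow_mul (Set.toFinite _) (Set.toFinite _),
    ncard_range_pow_mul, ncard_range_pow_mul, Set.ncard_univ, Nat.card_eq_fintype_card,
    ZMod.card_units]

theorem state_mem (x : (ZMod 1179647999)ˣ) :
    (state x).1 < 18000 ∧ (state x).2 < 2 ^ 16 ∧ state x ≠ (0, 0) ∧ state x ≠ (17999, 65535) := by
  have h : state x ∈ Set.range state := ⟨x, rfl⟩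
  rw [range_state] at h
  simpa [and_assoc] using h

/-- The non-trivial states of the MWC generator with multiplier 18000 form
exactly two disjoint orbits under `F 18000`, each of size `589823999`, whose
union is the whole state space minus the two trivial fixed points. -/
theorem mwc18000_two_orbits :
    ∃ s₁ s₂ : ℕ × ℕ,
      (s₁.1 < 18000 ∧ s₁.2 < 2 ^ 16 ∧ s₁ ≠ (0, 0) ∧ s₁ ≠ (17999, 65535)) ∧
      (s₂.1 < 18000 ∧ s₂.2 < 2 ^ 16 ∧ s₂ ≠ (0, 0) ∧ s₂ ≠ (17999, 65535)) ∧
      Disjoint (Set.range fun n : ℕ => (F 18000)^[n] s₁)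
        (Set.range fun n : ℕ => (F 18000)^[n] s₂) ∧
      (Set.range fun n : ℕ => (F 18000)^[n] s₁).ncard = 589823999 ∧
      (Set.range fun n : ℕ => (F 18000)^[n] s₂).ncard = 589823999 ∧
      (Set.range fun n : ℕ => (F 18000)^[n] s₁) ∪
          (Set.range fun n : ℕ => (F 18000)^[n] s₂) =
        {p : ℕ × ℕ | p.1 < 18000 ∧ p.2 < 2 ^ 16} \ {(0, 0), (17999, 65535)} := by
  refine ⟨state 1, state (-1), state_mem 1, state_mem (-1), ?_⟩
  simp only [range_iterate_state]
  refine ⟨(Set.disjoint_image_iff state_injective).2 disjoint_range_pow_mul, ?_, ?_, ?_⟩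
  · rw [Set.ncard_image_of_injective _ state_injective, ncard_range_pow_mul]
  · rw [Set.ncard_image_of_injective _ state_injective, ncard_range_pow_mul]
  · rw [← Set.image_union, range_pow_mul_union, Set.image_univ, range_state]
end

section
/- The combined MWC generator of the Monty Python implementation has period 589823999 · 1211400191 (approximately 2^59.3): for every non-trivial state s_w of the a = 18000 MWC generator and every non-trivial state s_z of the a = 36969 MWC generator, the least positive integer n such that simultaneously F₁₈₀₀₀^[n](s_w) = s_w and F₃₆₉₆₉^[n](s_z) = s_z is 589823999 · 1211400191. -/
/-- On states whose first component is below `a`, the encoding `(c, w) ↦ c + a * w` is injective. -/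
theorem encode_injOn {a : ℕ} {s t : ℕ × ℕ} (hs : s.1 < a) (ht : t.1 < a)
    (h : s.1 + a * s.2 = t.1 + a * t.2) : s = t := by
  have ha : 0 < a := by omega
  have h1 := congrArg (· % a) h
  have h2 := congrArg (· / a) h
  simp only [Nat.add_mul_mod_self_left, Nat.mod_eq_of_lt hs, Nat.mod_eq_of_lt ht] at h1
  simp only [Nat.add_mul_div_left _ _ ha, Nat.div_eq_of_lt hs, Nat.div_eq_of_lt ht,
    zero_add] at h2
  exact Prod.ext h1 h2

theorem encode_lt {a : ℕ} {s : ℕ × ℕ} (hs : s.1 < a ∧ s.2 < 2 ^ 16) :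
    s.1 + a * s.2 < a * 2 ^ 16 := by
  nlinarith [hs.1, Nat.mul_le_mul_left a (Nat.succ_le_of_lt hs.2)]

theorem F_mem {a : ℕ} {s : ℕ × ℕ} (hs : s.1 < a ∧ s.2 < 2 ^ 16) :
    (F a s).1 < a ∧ (F a s).2 < 2 ^ 16 :=
  ⟨Nat.div_lt_of_lt_mul ((encode_lt hs).trans_eq (mul_comm _ _)), Nat.mod_lt _ (by norm_num)⟩

theorem F_iterate_mem {a : ℕ} {s : ℕ × ℕ} (hs : s.1 < a ∧ s.2 < 2 ^ 16) (n : ℕ) :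
    ((F a)^[n] s).1 < a ∧ ((F a)^[n] s).2 < 2 ^ 16 := by
  induction n with
  | zero => exact hs
  | succ n ih => rw [Function.iterate_succ_apply']; exact F_mem ih

/-- Modulo `a * 2 ^ 16 - 1`, the transition function divides the encoding by `2 ^ 16`. -/
theorem two_pow_mul_encode_F {a p : ℕ} (hp : a * 2 ^ 16 = p + 1) (s : ℕ × ℕ) :
    (2 ^ 16 : ZMod p) * (((F a s).1 + a * (F a s).2 : ℕ) : ZMod p) =
      ((s.1 + a * s.2 : ℕ) : ZMod p) := by
  have h := Nat.div_add_mod (s.1 + a * s.2) (2 ^ 16)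
  have hp' : (a : ZMod p) * 2 ^ 16 = 1 := by
    have := congrArg (Nat.cast : ℕ → ZMod p) hp
    rw [Nat.cast_mul, Nat.cast_pow, Nat.cast_add] at this
    simpa only [Nat.cast_ofNat, ZMod.natCast_self, zero_add, Nat.cast_one] using this
  change 2 ^ 16 * (F a s).1 + (F a s).2 = _ at h
  rw [← h]
  push_cast
  linear_combination ((F a s).2 : ZMod p) * hp'

theorem two_pow_pow_mul_encode_iterate {a p : ℕ} (hp : a * 2 ^ 16 = p + 1) (s : ℕ × ℕ) (n : ℕ) :
    (2 ^ 16 : ZMod p) ^ n * ((((F a)^[n] s).1 + a * ((F a)^[n] s).2 : ℕ) : ZMod p) =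
      ((s.1 + a * s.2 : ℕ) : ZMod p) := by
  induction n with
  | zero => simp
  | succ n ih =>
    rw [Function.iterate_succ_apply', pow_succ, mul_assoc, two_pow_mul_encode_F hp, ih]

/-- A non-trivial state returns after `n` steps if and only if `2 ^ 16` has `n`-th power `1` modulo
the prime `a * 2 ^ 16 - 1`. -/
theorem F_iterate_eq_self_iff {a p : ℕ} [Fact p.Prime] (hp : a * 2 ^ 16 = p + 1) {s : ℕ × ℕ}
    (hs : s.1 < a ∧ s.2 < 2 ^ 16) (h0 : s ≠ (0, 0)) (h1 : s ≠ (a - 1, 65535)) (n : ℕ) :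
    (F a)^[n] s = s ↔ (2 ^ 16 : ZMod p) ^ n = 1 := by
  have key := two_pow_pow_mul_encode_iterate hp s n
  have hpos : 0 < s.1 + a * s.2 := by
    refine Nat.pos_of_ne_zero fun h => h0 (encode_injOn hs.1 (by simp; omega) ?_)
    simpa using h
  have hlt : s.1 + a * s.2 < p := by
    refine lt_of_le_of_ne (by have := encode_lt hs; omega) fun h =>
      h1 (encode_injOn hs.1 (by simp; omega) ?_)
    dsimp only
    omega
  constructor
  · intro h
    rw [h] at key
    refine mul_right_cancel₀ ?_ (key.trans (one_mul _).symm)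
    rw [Ne, ZMod.natCast_eq_zero_iff]
    exact Nat.not_dvd_of_pos_of_lt hpos hlt
  · intro h
    rw [h, one_mul, ZMod.natCast_eq_natCast_iff'] at key
    have ht := F_iterate_mem hs n
    refine encode_injOn ht.1 hs.1 ?_
    have hle := encode_lt ht
    rw [Nat.mod_eq_of_lt hlt] at key
    rcases (show _ ≤ p by omega : ((F a)^[n] s).1 + a * ((F a)^[n] s).2 ≤ p).lt_or_eq with h' | h'
    · rwa [Nat.mod_eq_of_lt h'] at key
    · rw [h', Nat.mod_self] at key
      omega

/-- Modulo a safe prime `2 * q + 1 > 2 ^ 16`, the element `2 ^ 16` has order `q`. -/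
theorem orderOf_two_pow_sixteen {p q : ℕ} [Fact p.Prime] [Fact q.Prime] (hpq : p = 2 * q + 1)
    (hlt : 2 ^ 16 < p) : orderOf (2 ^ 16 : ZMod p) = q := by
  have h2 : (2 : ZMod p) ≠ 0 := by
    have : ((2 : ℕ) : ZMod p) ≠ 0 := by
      rw [Ne, ZMod.natCast_eq_zero_iff]
      exact Nat.not_dvd_of_pos_of_lt (by norm_num) (by omega)
    exact_mod_cast this
  apply orderOf_eq_prime
  · have := ZMod.pow_card_sub_one_eq_one (pow_ne_zero 8 h2)
    rwa [show p - 1 = 2 * q by omega, pow_mul, ← pow_mul 2 8 2] at this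
  · intro h
    have h' : ((2 ^ 16 : ℕ) : ZMod p) = ((1 : ℕ) : ZMod p) := by exact_mod_cast h
    rw [ZMod.natCast_eq_natCast_iff', Nat.mod_eq_of_lt hlt, Nat.mod_eq_of_lt (by omega)] at h'
    norm_num at h'

/-- A non-trivial state of a generator whose modulus is a safe prime `2 * q + 1` has period `q`. -/
theorem F_iterate_eq_self_iff_dvd {a p q : ℕ} (hp : p.Prime) (hq : q.Prime)
    (hap : a * 2 ^ 16 = p + 1) (hpq : p = 2 * q + 1) (hlt : 2 ^ 16 < p) {s : ℕ × ℕ}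
    (hs : s.1 < a ∧ s.2 < 2 ^ 16) (h0 : s ≠ (0, 0)) (h1 : s ≠ (a - 1, 65535)) (n : ℕ) :
    (F a)^[n] s = s ↔ q ∣ n := by
  have := Fact.mk hp
  have := Fact.mk hq
  rw [F_iterate_eq_self_iff hap hs h0 h1, ← orderOf_dvd_iff_pow_eq_one,
    orderOf_two_pow_sixteen hpq hlt]

/-- The Lucas primality test, given a list of primes with product `p - 1`. -/
theorem prime_of_lucas_list {p : ℕ} (a : ZMod p) (l : List ℕ) (hl : ∀ q ∈ l, q.Prime)
    (hprod : l.prod = p - 1) (ha : a ^ (p - 1) = 1) (hd : ∀ q ∈ l, a ^ ((p - 1) / q) ≠ 1) :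
    p.Prime := by
  refine lucas_primality p a ha fun q hq hdvd => hd q ?_
  rw [← hprod, hq.prime.dvd_prod_iff] at hdvd
  obtain ⟨r, hr, hqr⟩ := hdvd
  rwa [(Nat.prime_dvd_prime_iff_eq hq (hl r hr)).1 hqr]

theorem ZMod.ofNat_ne_one_of_lt {p n : ℕ} [n.AtLeastTwo] (h : n < p) :
    (OfNat.ofNat n : ZMod p) ≠ 1 := by
  have hn : 2 ≤ n := Nat.AtLeastTwo.prop
  intro h'
  have h1 : ((n : ℕ) : ZMod p) = ((1 : ℕ) : ZMod p) := by rw [Nat.cast_one]; exact h'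
  rw [ZMod.natCast_eq_natCast_iff', Nat.mod_eq_of_lt h, Nat.mod_eq_of_lt (by omega)] at h1
  omega

theorem prime_1211400191 : Nat.Prime 1211400191 := by
  refine prime_of_lucas_list 7 [2, 5, 7, 11, 13, 121019] ?_ (by norm_num)
    (by norm_num1; reduce_mod_char) ?_
  · norm_num
  · simp only [List.forall_mem_cons]
    refine ⟨?_, ?_, ?_, ?_, ?_, ?_, by simp⟩ <;> norm_num1 <;> reduce_mod_char <;>
      exact ZMod.ofNat_ne_one_of_lt (by norm_num)

theorem prime_2422800383 : Nat.Prime 2422800383 := by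
  refine prime_of_lucas_list 5 [2, 1211400191] ?_ (by norm_num)
    (by norm_num1; reduce_mod_char) ?_
  · simp only [List.forall_mem_cons]
    exact ⟨Nat.prime_two, prime_1211400191, by simp⟩
  · simp only [List.forall_mem_cons]
    refine ⟨?_, ?_, by simp⟩ <;> norm_num1 <;> reduce_mod_char <;>
      exact ZMod.ofNat_ne_one_of_lt (by norm_num)

/-- The combined MWC generator of the Monty Python implementation has period
`589823999 * 1211400191`: for every non-trivial state `sw` of the `a = 18000`
generator and every non-trivial state `sz` of the `a = 36969` generator, the
least positive `n` fixing both simultaneously is `589823999 * 1211400191`. -/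
theorem mwc_combined_period (sw sz : ℕ × ℕ)
    (hw : sw.1 < 18000 ∧ sw.2 < 2 ^ 16) (hw0 : sw ≠ (0, 0)) (hw1 : sw ≠ (17999, 65535))
    (hz : sz.1 < 36969 ∧ sz.2 < 2 ^ 16) (hz0 : sz ≠ (0, 0)) (hz1 : sz ≠ (36968, 65535)) :
    IsLeast {n : ℕ | 0 < n ∧ (F 18000)^[n] sw = sw ∧ (F 36969)^[n] sz = sz}
      (589823999 * 1211400191) := by
  have hw' := F_iterate_eq_self_iff_dvd (p := 1179647999) prime_1179647999 prime_589823999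
    (by norm_num) (by norm_num) (by norm_num) hw hw0 hw1
  have hz' := F_iterate_eq_self_iff_dvd (p := 2422800383) prime_2422800383 prime_1211400191
    (by norm_num) (by norm_num) (by norm_num) hz hz0 hz1
  refine ⟨⟨by norm_num, (hw' _).2 (dvd_mul_right _ _), (hz' _).2 (dvd_mul_left _ _)⟩, ?_⟩
  rintro n ⟨hn, h₁, h₂⟩
  have hco : Nat.Coprime 589823999 1211400191 := by norm_num
  exact Nat.le_of_dvd hn (hco.mul_dvd_of_dvd_of_dvd ((hw' n).1 h₁) ((hz' n).1 h₂))
end
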